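/- Let d ≥ 2. Then ∫₀^∞ t · | ∫_{ℝ^d} cos(2ξ_d t)(1 − |ξ|²)_+ dξ | dt < ∞; that is, there is a finite constant C (depending only on d) bounding this integral. -/

import Mathlib

open MeasureTheory Real Metric Set

noncomputable section

abbrev Euc (d : ℕ) := EuclideanSpace ℝ (Fin d)

/-- Last coordinate of x ∈ ℝ^d. -/
def lastCoord {d : ℕ} (x : Euc d) : ℝ :=
  if h : 0 < d then x ⟨d - 1, by omega⟩ else 0

/-- Solutions of `t H₂ + m H₁ + 4 t H = 0` decay at least like `t ^ (-m / 2)`: a perturbed energy is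
nonincreasing on `[1, ∞)`. -/
theorem mul_pow_le_of_bessel_ode {H H₁ H₂ : ℝ → ℝ} (m : ℕ)
    (h₁ : ∀ t, HasDerivAt H (H₁ t) t) (h₂ : ∀ t, HasDerivAt H₁ (H₂ t) t) (hm : 2 ≤ m)
    (ode : ∀ t, t * H₂ t + m * H₁ t + 4 * t * H t = 0) :
    ∃ C, ∀ t, 1 ≤ t → H t ^ 2 * t ^ m ≤ C := by
  set b : ℝ := m / 2 with hb
  set k : ℝ := b * (b - 1) / 2 with hk
  have hb1 : 1 ≤ b := by
    have : (2 : ℝ) ≤ m := by exact_mod_cast hm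
    rw [hb]; linarith
  have hk0 : 0 ≤ k := by rw [hk]; nlinarith
  let P : ℝ → ℝ := fun t => b * t⁻¹ * H t + H₁ t
  let E : ℝ → ℝ := fun t => P t ^ 2 + 4 * H t ^ 2
  let F : ℝ → ℝ := fun t => t ^ m * (Real.exp (k * t⁻¹) * E t)
  have hF : ∀ t, 1 ≤ t → ∃ D ≤ 0, HasDerivAt F D t := by
    intro t ht
    have t0 : t ≠ 0 := by linarith
    have dP : HasDerivAt P (b * (-(t ^ 2)⁻¹) * H t + b * t⁻¹ * H₁ t + H₂ t) t :=
      (((hasDerivAt_inv t0).const_mul b).mul (h₁ t)).add (h₂ t)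
    have dE : HasDerivAt E _ t := (dP.pow 2).add (((h₁ t).pow 2).const_mul 4)
    have dF : HasDerivAt F _ t :=
      (hasDerivAt_pow m t).mul ((((hasDerivAt_inv t0).const_mul k).exp).mul dE)
    refine ⟨_, ?_, dF⟩
    have e2 : H₂ t = -(2 * b * t⁻¹ * H₁ t) - 4 * H t := by
      have := ode t
      have hm' : (m : ℝ) = 2 * b := by rw [hb]; ring
      rw [hm'] at this
      field_simp
      linarith
    have e1 : H₁ t = P t - b * t⁻¹ * H t := by simp only [P]; ring
    have epow : (m : ℝ) * t ^ (m - 1) = t ^ m * (2 * b * t⁻¹) := by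
      obtain ⟨j, rfl⟩ : ∃ j, m = j + 1 := ⟨m - 1, by omega⟩
      rw [hb, Nat.add_sub_cancel, pow_succ]
      field_simp
    have key : 4 * k * (P t * H t) ≤ k * E t := by
      simp only [E]
      nlinarith [mul_nonneg hk0 (sq_nonneg (P t - 2 * H t))]
    have : t ^ m * Real.exp (k * t⁻¹) * ((t ^ 2)⁻¹ * (4 * k * (P t * H t) - k * E t)) ≤ 0 := by
      have p1 : 0 ≤ t ^ m * Real.exp (k * t⁻¹) := by positivity
      have p2 : 0 ≤ (t ^ 2)⁻¹ := by positivity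
      exact mul_nonpos_of_nonneg_of_nonpos p1 (mul_nonpos_of_nonneg_of_nonpos p2 (by linarith))
    refine le_of_eq_of_le ?_ this
    rw [epow, e2, e1]
    simp only [E, hk]
    push_cast
    generalize P t = p
    field_simp
    ring
  have anti : AntitoneOn F (Ici 1) := by
    refine antitoneOn_of_deriv_nonpos (convex_Ici 1) ?_ ?_ ?_
    · intro t ht
      obtain ⟨D, -, h⟩ := hF t ht
      exact h.continuousAt.continuousWithinAt
    · intro t ht
      obtain ⟨D, -, h⟩ := hF t (interior_subset ht)
      exact h.differentiableAt.differentiableWithinAt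
    · intro t ht
      obtain ⟨D, h0, h⟩ := hF t (interior_subset ht)
      rwa [h.deriv]
  refine ⟨F 1, fun t ht => ?_⟩
  refine le_trans ?_ (anti (mem_Ici.2 le_rfl) ht ht)
  simp only [F]
  rw [mul_comm]
  have t0 : 0 < t := by linarith
  gcongr
  have h1 : 1 ≤ Real.exp (k * t⁻¹) := Real.one_le_exp (by positivity)
  have h2 : H t ^ 2 ≤ E t := by simp only [E]; nlinarith [sq_nonneg (P t), sq_nonneg (H t)]
  nlinarith [sq_nonneg (H t)]

/-- Derivative under the integral sign for a cosine transform. -/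
theorem hasDerivAt_integral_cos {w : ℝ → ℝ} (hw : Continuous w) (t : ℝ) :
    HasDerivAt (fun t => ∫ s in (-1 : ℝ)..1, Real.cos (2 * s * t) * w s)
      (∫ s in (-1 : ℝ)..1, Real.sin (2 * s * t) * (-2 * s * w s)) t := by
  have h := (intervalIntegral.hasDerivAt_integral_of_dominated_loc_of_deriv_le (μ := volume)
    (F := fun t s => Real.cos (2 * s * t) * w s)
    (F' := fun t s => Real.sin (2 * s * t) * (-2 * s * w s))
    (bound := fun s => |-2 * s * w s|) (a := -1) (b := 1) (x₀ := t) (s := univ)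
    Filter.univ_mem ?_ ?_ ?_ ?_ ?_ ?_).2
  · exact h
  · exact .of_forall fun x => Continuous.aestronglyMeasurable (by fun_prop)
  · exact Continuous.intervalIntegrable (by fun_prop) _ _
  · exact Continuous.aestronglyMeasurable (by fun_prop)
  · refine .of_forall fun s _ x _ => ?_
    rw [norm_mul, Real.norm_eq_abs, Real.norm_eq_abs]
    exact mul_le_of_le_one_left (abs_nonneg _) (Real.abs_sin_le_one _)
  · exact Continuous.intervalIntegrable (by fun_prop) _ _
  · refine .of_forall fun s _ x _ => ?_
    have := (((hasDerivAt_id x).const_mul (2 * s)).cos).mul_const (w s)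
    exact this.congr_deriv (by simp only [id]; ring)

/-- Derivative under the integral sign for a sine transform. -/
theorem hasDerivAt_integral_sin {w : ℝ → ℝ} (hw : Continuous w) (t : ℝ) :
    HasDerivAt (fun t => ∫ s in (-1 : ℝ)..1, Real.sin (2 * s * t) * w s)
      (∫ s in (-1 : ℝ)..1, Real.cos (2 * s * t) * (2 * s * w s)) t := by
  have h := (intervalIntegral.hasDerivAt_integral_of_dominated_loc_of_deriv_le (μ := volume)
    (F := fun t s => Real.sin (2 * s * t) * w s)
    (F' := fun t s => Real.cos (2 * s * t) * (2 * s * w s))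
    (bound := fun s => |2 * s * w s|) (a := -1) (b := 1) (x₀ := t) (s := univ)
    Filter.univ_mem ?_ ?_ ?_ ?_ ?_ ?_).2
  · exact h
  · exact .of_forall fun x => Continuous.aestronglyMeasurable (by fun_prop)
  · exact Continuous.intervalIntegrable (by fun_prop) _ _
  · exact Continuous.aestronglyMeasurable (by fun_prop)
  · refine .of_forall fun s _ x _ => ?_
    rw [norm_mul, Real.norm_eq_abs, Real.norm_eq_abs]
    exact mul_le_of_le_one_left (abs_nonneg _) (Real.abs_cos_le_one _)
  · exact Continuous.intervalIntegrable (by fun_prop) _ _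
  · refine .of_forall fun s _ x _ => ?_
    have := (((hasDerivAt_id x).const_mul (2 * s)).sin).mul_const (w s)
    exact this.congr_deriv (by simp only [id]; ring)

/-- The Bessel-type equation `t H₂ + (2a + 2) H₁ + 4 t H = 0`, with `H₁`, `H₂` the
derivatives, for the cosine transform `H` of `(1 - s²)^a`. -/
theorem bessel_ode {a : ℝ} (ha : 0 ≤ a) (t : ℝ) :
    t * (∫ s in (-1 : ℝ)..1, Real.cos (2 * s * t) * (2 * s * (-2 * s * (1 - s ^ 2) ^ a))) +
      (2 * a + 2) * (∫ s in (-1 : ℝ)..1, Real.sin (2 * s * t) * (-2 * s * (1 - s ^ 2) ^ a)) +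
      4 * t * (∫ s in (-1 : ℝ)..1, Real.cos (2 * s * t) * (1 - s ^ 2) ^ a) = 0 := by
  have hw : Continuous fun s : ℝ => (1 - s ^ 2) ^ a :=
    (by fun_prop : Continuous fun s : ℝ => 1 - s ^ 2).rpow_const fun _ => Or.inr ha
  rw [← intervalIntegral.integral_const_mul, ← intervalIntegral.integral_const_mul,
    ← intervalIntegral.integral_const_mul, ← intervalIntegral.integral_add,
    ← intervalIntegral.integral_add]
  rotate_left
  iterate 4 exact Continuous.intervalIntegrable (by fun_prop) _ _
  have hd : ∀ s ∈ uIcc (-1 : ℝ) 1,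
      HasDerivAt (fun s : ℝ => 2 * (Real.sin (2 * s * t) * (1 - s ^ 2) ^ (a + 1)))
        (t * (Real.cos (2 * s * t) * (2 * s * (-2 * s * (1 - s ^ 2) ^ a))) +
          (2 * a + 2) * (Real.sin (2 * s * t) * (-2 * s * (1 - s ^ 2) ^ a)) +
          4 * t * (Real.cos (2 * s * t) * (1 - s ^ 2) ^ a)) s := by
    intro s hs
    rw [uIcc_of_le (by norm_num)] at hs
    have h0 : 0 ≤ 1 - s ^ 2 := by nlinarith [hs.1, hs.2]
    have d1 := (((hasDerivAt_pow 2 s).const_sub 1).rpow_const (p := a + 1) (Or.inr (by linarith)))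
    have d2 := ((((hasDerivAt_id s).const_mul 2).mul_const t).sin)
    have d3 := (d2.mul d1).const_mul 2
    refine d3.congr_deriv ?_
    rw [add_sub_cancel_right, Real.rpow_add_one' h0 (by linarith)]
    simp only [id]
    push_cast
    ring
  rw [intervalIntegral.integral_eq_sub_of_hasDerivAt hd
    (Continuous.intervalIntegrable (by fun_prop) _ _)]
  have : a + 1 ≠ 0 := by linarith
  simp [Real.zero_rpow this]

theorem integral_max_sub_sum_sq (n : ℕ) (s : ℝ) :
    ∫ y : Fin n → ℝ, max (1 - s ^ 2 - ∑ i, y i ^ 2) 0 =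
      (max (1 - s ^ 2) 0) ^ ((n + 2 : ℝ) / 2) * ∫ y : Fin n → ℝ, max (1 - ∑ i, y i ^ 2) 0 := by
  rcases le_or_gt (1 - s ^ 2) 0 with h | h
  · rw [max_eq_right h, Real.zero_rpow (by positivity), zero_mul]
    refine integral_eq_zero_of_ae (.of_forall fun y => ?_)
    have : 0 ≤ ∑ i, y i ^ 2 := Finset.sum_nonneg fun i _ => sq_nonneg _
    simp only [Pi.zero_apply]
    exact max_eq_right (by linarith)
  · set r := √(1 - s ^ 2) with hr
    have hr0 : 0 < r := Real.sqrt_pos.2 h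
    have hr2 : r ^ 2 = 1 - s ^ 2 := Real.sq_sqrt h.le
    have hs := Measure.integral_comp_smul (volume : Measure (Fin n → ℝ))
      (fun y => max (1 - s ^ 2 - ∑ i, y i ^ 2) 0) r
    have e : ∀ y : Fin n → ℝ, max (1 - s ^ 2 - ∑ i, (r • y) i ^ 2) 0
        = r ^ 2 * max (1 - ∑ i, y i ^ 2) 0 := by
      intro y
      rw [mul_max_of_nonneg _ _ (sq_nonneg r), mul_zero, mul_sub, mul_one, hr2, Finset.mul_sum]
      simp [mul_pow, hr2]
    simp only [e] at hs
    rw [integral_const_mul, Module.finrank_fin_fun, smul_eq_mul, abs_of_pos (by positivity)] at hs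
    have ep : (1 - s ^ 2) ^ ((n + 2 : ℝ) / 2) = r ^ n * r ^ 2 := by
      rw [← hr2, ← pow_add, ← Real.rpow_natCast r (n + 2), ← Real.rpow_natCast r 2,
        ← Real.rpow_mul hr0.le]
      congr 1
      push_cast
      ring
    rw [max_eq_left h.le, ep, mul_assoc, hs]
    field_simp

/-- Integrating out the first coordinates reduces the transform to one dimension. -/
theorem integral_cos_lastCoord (n : ℕ) (t : ℝ) :
    ∫ ξ : Euc (n + 1), Real.cos (2 * lastCoord ξ * t) * max (1 - ‖ξ‖ ^ 2) 0 =
      (∫ y : Fin n → ℝ, max (1 - ∑ i, y i ^ 2) 0) *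
        ∫ s in (-1 : ℝ)..1, Real.cos (2 * s * t) * (1 - s ^ 2) ^ ((n + 2 : ℝ) / 2) := by
  let g : ℝ × (Fin n → ℝ) → ℝ := fun p =>
    Real.cos (2 * p.1 * t) * max (1 - p.1 ^ 2 - ∑ i, p.2 i ^ 2) 0
  have hgc : Continuous g := by fun_prop
  have hgs : HasCompactSupport g := by
    refine HasCompactSupport.intro (isCompact_closedBall 0 1) fun p hp => ?_
    suffices h : 1 - p.1 ^ 2 - ∑ i, p.2 i ^ 2 ≤ 0 by simp only [g]; rw [max_eq_right h, mul_zero]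
    by_contra! h
    have hs : 0 ≤ ∑ i, p.2 i ^ 2 := Finset.sum_nonneg fun i _ => sq_nonneg _
    refine hp ?_
    rw [mem_closedBall_zero_iff, Prod.norm_def]
    refine max_le ?_ ((pi_norm_le_iff_of_nonneg zero_le_one).2 fun i => ?_)
    · rw [Real.norm_eq_abs]
      exact (sq_le_one_iff_abs_le_one _).1 (by linarith)
    · rw [Real.norm_eq_abs]
      have : p.2 i ^ 2 ≤ ∑ i, p.2 i ^ 2 :=
        Finset.single_le_sum (f := fun i => p.2 i ^ 2) (fun i _ => sq_nonneg _) (Finset.mem_univ i)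
      exact (sq_le_one_iff_abs_le_one _).1 (by nlinarith [sq_nonneg p.1])
  have hgi : Integrable g := hgc.integrable_of_hasCompactSupport hgs
  let e := MeasurableEquiv.piFinSuccAbove (fun _ : Fin (n + 1) => ℝ) (Fin.last n)
  have h1 : ∀ ξ : Euc (n + 1), Real.cos (2 * lastCoord ξ * t) * max (1 - ‖ξ‖ ^ 2) 0 =
      g (e ((MeasurableEquiv.toLp 2 (Fin (n + 1) → ℝ)).symm ξ)) := by
    intro ξ
    have hl : lastCoord ξ = ξ (Fin.last n) := by
      simp only [lastCoord, Nat.succ_pos, dif_pos]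
      rfl
    have hn : ‖ξ‖ ^ 2 = ξ (Fin.last n) ^ 2 + ∑ i : Fin n, ξ ((Fin.last n).succAbove i) ^ 2 := by
      rw [EuclideanSpace.norm_sq_eq, Fin.sum_univ_succAbove _ (Fin.last n)]
      simp only [Real.norm_eq_abs, sq_abs]
    rw [hl, hn, ← sub_sub]
    rfl
  simp only [h1]
  have m1 : MeasurePreserving (MeasurableEquiv.toLp 2 (Fin (n + 1) → ℝ)).symm :=
    PiLp.volume_preserving_ofLp (Fin (n + 1))
  have m2 : MeasurePreserving e := volume_preserving_piFinSuccAbove _ _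
  rw [m1.integral_comp' (g := fun x => g (e x)), m2.integral_comp' (g := g), Measure.volume_eq_prod,
    integral_prod g hgi,
    intervalIntegral.integral_of_le (by norm_num), ← integral_Icc_eq_integral_Ioc]
  simp only [g]
  simp only [integral_const_mul, integral_max_sub_sum_sq]
  rw [← setIntegral_eq_integral_of_forall_compl_eq_zero (s := Icc (-1 : ℝ) 1),
    ← integral_const_mul]
  · refine setIntegral_congr_fun measurableSet_Icc fun s hs => ?_
    have : 0 ≤ 1 - s ^ 2 := by nlinarith [hs.1, hs.2]
    rw [max_eq_left this]
    ring
  · intro s hs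
    have : 1 - s ^ 2 ≤ 0 := by
      by_contra! h
      exact hs (abs_le.1 ((sq_le_one_iff_abs_le_one s).1 (by linarith)))
    rw [max_eq_right this, Real.zero_rpow (by positivity)]
    simp

/-- ∫₀^∞ t |∫_{ℝ^d} cos(2ξ_d t)(1-|ξ|²)_+ dξ| dt is finite, i.e. the
(nonnegative) integrand is integrable on (0,∞), so the integral is bounded by a
finite constant depending only on d. -/
theorem bessel_tail_integrable
    (d : ℕ) (hd : 2 ≤ d) :
    IntegrableOn
      (fun t : ℝ =>
        t * |∫ ξ : Euc d, Real.cos (2 * lastCoord ξ * t) * max (1 - ‖ξ‖^2) 0|)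
      (Set.Ioi 0) ∧
    ∃ C : ℝ, 0 < C ∧
      (∫ t in Set.Ioi (0:ℝ),
        t * |∫ ξ : Euc d, Real.cos (2 * lastCoord ξ * t) * max (1 - ‖ξ‖^2) 0|) ≤ C := by
  refine ⟨?_, _, lt_max_of_lt_right one_pos, le_max_left _ _⟩
  obtain ⟨n, rfl⟩ : ∃ n, d = n + 1 := ⟨d - 1, by omega⟩
  simp only [integral_cos_lastCoord, abs_mul]
  generalize |∫ y : Fin n → ℝ, max (1 - ∑ i, y i ^ 2) 0| = c
  have ha : (0 : ℝ) ≤ (n + 2 : ℝ) / 2 := by positivity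
  have hw : Continuous fun s : ℝ => (1 - s ^ 2) ^ ((n + 2 : ℝ) / 2) :=
    (by fun_prop : Continuous fun s : ℝ => 1 - s ^ 2).rpow_const fun _ => Or.inr ha
  have h₁ := hasDerivAt_integral_cos hw
  have h₂ := hasDerivAt_integral_sin
    (by fun_prop : Continuous fun s : ℝ => -2 * s * (1 - s ^ 2) ^ ((n + 2 : ℝ) / 2))
  obtain ⟨C, hC⟩ := mul_pow_le_of_bessel_ode (n + 4) h₁ h₂ (by omega) fun t => by
    rw [← bessel_ode ha t]
    push_cast
    ring
  set H : ℝ → ℝ := fun t => ∫ s in (-1 : ℝ)..1, Real.cos (2 * s * t) *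
    (1 - s ^ 2) ^ ((n + 2 : ℝ) / 2) with hH
  have hHc : Continuous H := continuous_iff_continuousAt.2 fun t => (h₁ t).continuousAt
  have hfc : Continuous fun t => t * (c * |H t|) := by fun_prop
  rw [← Ioc_union_Ioi_eq_Ioi (zero_le_one (α := ℝ)), integrableOn_union]
  refine ⟨(hfc.integrableOn_Icc (a := 0) (b := 1)).mono_set Ioc_subset_Icc_self, ?_⟩
  refine Integrable.mono' ((integrableOn_Ioi_rpow_of_lt (a := -(3 / 2)) (by norm_num)
    one_pos).const_mul (|c| * √C)) hfc.aestronglyMeasurable ?_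
  filter_upwards [ae_restrict_mem measurableSet_Ioi] with t ht
  have ht1 : 1 ≤ t := (mem_Ioi.1 ht).le
  have t0 : 0 < t := by linarith
  have hb : |H t| * t ^ (5 / 2 : ℝ) ≤ √C := by
    refine Real.le_sqrt_of_sq_le (le_trans ?_ (hC t ht1))
    rw [mul_pow, sq_abs, ← Real.rpow_mul_natCast t0.le]
    gcongr
    rw [← Real.rpow_natCast]
    refine Real.rpow_le_rpow_of_exponent_le ht1 ?_
    have : (1 : ℝ) ≤ n := by exact_mod_cast (by omega : 1 ≤ n)
    push_cast
    linarith
  rw [norm_mul, norm_mul, Real.norm_eq_abs, Real.norm_eq_abs, Real.norm_eq_abs, abs_abs,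
    abs_of_pos t0]
  have e : t = t ^ (5 / 2 : ℝ) * t ^ (-(3 / 2) : ℝ) := by
    rw [← Real.rpow_add t0]
    norm_num
  calc t * (|c| * |H t|) = |c| * (|H t| * t ^ (5 / 2 : ℝ)) * t ^ (-(3 / 2) : ℝ) := by
        nth_rewrite 1 [e]
        ring
    _ ≤ |c| * √C * t ^ (-(3 / 2) : ℝ) := by gcongr
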